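/- arXiv:1610.07891 — 5 statements merged into one kernel-verified Lean document; each statement's English description precedes it below -/
import Mathlib

section
/- Let a, b ∈ H_J. Then the Euclidean inner product ev_J(X^a)·ev_J(X^b) = Σ_{P∈Z_J} P^a·P^b is nonzero if and only if both of the following hold: (1) for every j ∈ J, a_j + b_j ≡ 0 (mod N_j − 1); (2) for every j ∉ J, either a_j + b_j > 0 and a_j + b_j ≡ 0 (mod N_j − 1), or a_j = b_j = 0 and p does not divide N_j. -/
/-- A finite field contains a primitive `n`-th root of unity for every `n` dividing the order of
its group of units. -/
lemma exists_isPrimitiveRoot_of_dvd_card_sub_one {F : Type*} [Field F] [Fintype F] {n : ℕ}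
    (hn : n ∣ Fintype.card F - 1) : ∃ ζ : F, IsPrimitiveRoot ζ n := by
  classical
  obtain ⟨g, hg⟩ := IsCyclic.exists_generator (α := Fˣ)
  have ho : orderOf g = Fintype.card F - 1 := by
    rw [orderOf_eq_card_of_forall_mem_zpowers hg, Nat.card_eq_fintype_card, Fintype.card_units]
  have hpos : 0 < Fintype.card F - 1 := Nat.sub_pos_of_lt Fintype.one_lt_card
  obtain ⟨c, hc⟩ := hn
  refine ⟨((g ^ c : Fˣ) : F), IsPrimitiveRoot.coe_units_iff.mpr ?_⟩
  exact (ho ▸ IsPrimitiveRoot.orderOf g).pow hpos (by rw [hc, mul_comm])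

/-- The sum of the `k`-th powers of the `n`-th roots of unity. -/
lemma IsPrimitiveRoot.sum_filter_pow_eq_one {F : Type*} [Field F] [Fintype F] [DecidableEq F]
    {n : ℕ} {ζ : F} (hζ : IsPrimitiveRoot ζ n) (hn : 0 < n) (k : ℕ) :
    ∑ x ∈ Finset.univ.filter (fun x : F => x ^ n = 1), x ^ k = if n ∣ k then (n : F) else 0 := by
  have hset : Finset.univ.filter (fun x : F => x ^ n = 1) =
      Polynomial.nthRootsFinset n (1 : F) := by
    ext x
    simp [Polynomial.mem_nthRootsFinset hn]
  split_ifs with hk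
  · obtain ⟨c, rfl⟩ := hk
    rw [Finset.sum_congr rfl (g := fun _ => (1 : F)), hset]
    · simp [hζ.card_nthRootsFinset]
    · intro x hx
      rw [pow_mul, (Finset.mem_filter.mp hx).2, one_pow]
  · have hζ0 : ζ ≠ 0 := hζ.ne_zero hn.ne'
    have h : ∑ x ∈ Finset.univ.filter (fun x : F => x ^ n = 1), (ζ * x) ^ k =
        ∑ x ∈ Finset.univ.filter (fun x : F => x ^ n = 1), x ^ k := by
      refine Finset.sum_equiv (Equiv.mulLeft₀ ζ hζ0) (fun x => ?_) (fun x _ => by simp)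
      simp [mul_pow, hζ.pow_eq_one]
    simp_rw [mul_pow, ← Finset.mul_sum] at h
    by_contra hS
    exact hk ((hζ.pow_eq_one_iff_dvd k).mp (mul_right_cancel₀ hS (h.trans (one_mul _).symm)))

/-- The sum of the `k`-th powers of the solutions of `x ^ (n + 1) = x`. -/
lemma IsPrimitiveRoot.sum_filter_pow_succ_eq_self {F : Type*} [Field F] [Fintype F]
    [DecidableEq F] {n : ℕ} {ζ : F} (hζ : IsPrimitiveRoot ζ n) (hn : 0 < n) (k : ℕ) :
    ∑ x ∈ Finset.univ.filter (fun x : F => x ^ (n + 1) = x), x ^ k =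
      0 ^ k + if n ∣ k then (n : F) else 0 := by
  have hset : Finset.univ.filter (fun x : F => x ^ (n + 1) = x) =
      insert 0 (Finset.univ.filter (fun x : F => x ^ n = 1)) := by
    ext x
    by_cases hx : x = 0
    · simp [hx]
    · simp [hx, pow_succ]
  rw [hset, Finset.sum_insert (by simp [hn.ne']), hζ.sum_filter_pow_eq_one hn]

/-- Proposition 1 of the paper. Euclidean inner product of the
evaluations of two monomials over the points of the `J`-affine variety is nonzero
iff the stated congruence conditions hold. -/
theorem euclidean_inner_product_of_monomials_ne_zero_iff
    (p e m : ℕ) (hp : p.Prime) (he : 0 < e)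
    (F : Type) [Field F] [Fintype F] [DecidableEq F]
    (hF : Fintype.card F = p ^ e)
    (N : Fin m → ℕ) (hN : ∀ j, 1 < N j)
    (hNdvd : ∀ j, (N j - 1) ∣ (Fintype.card F - 1))
    (J : Finset (Fin m))
    (a b : Fin m → ℕ)
    (ha : ∀ j, a j ≤ N j - 1 - (if j ∈ J then 1 else 0))
    (hb : ∀ j, b j ≤ N j - 1 - (if j ∈ J then 1 else 0)) :
    (∑ P ∈ Finset.univ.filter (fun x : Fin m → F =>
        ∀ j, (j ∈ J → x j ^ (N j - 1) = 1) ∧ (j ∉ J → x j ^ (N j) = x j)),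
      (∏ j, P j ^ a j) * (∏ j, P j ^ b j)) ≠ 0 ↔
    ((∀ j ∈ J, (N j - 1) ∣ (a j + b j)) ∧
     (∀ j ∉ J, (0 < a j + b j ∧ (N j - 1) ∣ (a j + b j)) ∨
        (a j = 0 ∧ b j = 0 ∧ ¬ p ∣ N j))) := by
  have : Fact p.Prime := ⟨hp⟩
  have hchar : CharP F p := charP_of_card_eq_prime_pow hF
  have hpos : ∀ j, 0 < N j - 1 := fun j => Nat.sub_pos_of_lt (hN j)
  have hcast : ∀ j, ((N j - 1 : ℕ) : F) ≠ 0 := by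
    intro j h
    have h1 : p ∣ p ^ e - 1 := hF ▸ ((CharP.cast_eq_zero_iff F p _).mp h).trans (hNdvd j)
    have h2 : p ∣ p ^ e := dvd_pow_self p he.ne'
    have h3 : p ∣ 1 := by
      have := Nat.dvd_sub h2 h1
      rwa [Nat.sub_sub_self (Nat.one_le_pow _ _ hp.pos)] at this
    exact hp.one_lt.ne' (Nat.dvd_one.mp h3)
  have hset : Finset.univ.filter (fun x : Fin m → F =>
        ∀ j, (j ∈ J → x j ^ (N j - 1) = 1) ∧ (j ∉ J → x j ^ (N j) = x j)) =
      Fintype.piFinset fun j => Finset.univ.filter (fun y : F =>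
        (j ∈ J → y ^ (N j - 1) = 1) ∧ (j ∉ J → y ^ (N j) = y)) := by
    ext x
    simp [Fintype.mem_piFinset]
  simp_rw [← Finset.prod_mul_distrib, ← pow_add]
  rw [hset, ← Finset.prod_univ_sum _ (fun j y => y ^ (a j + b j)), Finset.prod_ne_zero_iff,
    ← forall_and]
  simp only [Finset.mem_univ, true_imp_iff]
  refine forall_congr' fun j => ?_
  obtain ⟨ζ, hζ⟩ := exists_isPrimitiveRoot_of_dvd_card_sub_one (hNdvd j)
  by_cases hj : j ∈ J
  · simp only [hj, true_imp_iff, not_true_eq_false, false_imp_iff, and_true]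
    rw [hζ.sum_filter_pow_eq_one (hpos j)]
    simp [hcast j]
  · simp only [hj, false_imp_iff, not_false_eq_true, true_imp_iff, true_and]
    have hN1 : N j - 1 + 1 = N j := Nat.sub_add_cancel (hN j).le
    have hsum := hζ.sum_filter_pow_succ_eq_self (hpos j) (a j + b j)
    rw [hN1] at hsum
    rw [hsum]
    rcases Nat.eq_zero_or_pos (a j + b j) with h0 | h0
    · have hN2 : (1 : F) + ((N j - 1 : ℕ) : F) = (N j : F) := by
        rw [add_comm]
        exact_mod_cast congrArg (Nat.cast (R := F)) hN1
      obtain ⟨ha0, hb0⟩ := Nat.add_eq_zero_iff.mp h0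
      simp [ha0, hb0, hN2, CharP.cast_eq_zero_iff F p]
    · have hab : ¬ (a j = 0 ∧ b j = 0 ∧ ¬ p ∣ N j) := fun h => by omega
      simp [h0, hab, hcast j, zero_pow h0.ne', -Nat.add_eq_zero_iff, -add_pos_iff]
end

section
/- Let p be a prime and r a positive integer. (i) If r is even, then for every integer j ≥ 0 the least nonnegative residue of p^j·(p^{r/2} − 1) modulo p^r − 1 is at least p^{r/2} − 1; that is, p^{r/2} − 1 is the minimum element of its cyclotomic coset modulo p^r − 1 with respect to p. (ii) If r ≥ 3 is odd, then for every integer j ≥ 0 the least nonnegative residue of p^j·(p^{(r+1)/2} − p − 1) modulo p^r − 1 is at least p^{(r+1)/2} − p − 1; that is, p^{(r+1)/2} − p − 1 is the minimum element of its cyclotomic coset modulo p^r − 1 with respect to p. -/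
theorem Nat.le_mod_of_int_dvd_sub {a b n : ℕ} {s : ℤ} (has : (a : ℤ) ≤ s) (hsn : s < n)
    (hdvd : (n : ℤ) ∣ b - s) : a ≤ b % n := by
  have h : ((b % n : ℕ) : ℤ) = s := by
    rw [Int.natCast_mod, Int.emod_eq_emod_iff_emod_sub_eq_zero.2 (Int.emod_eq_zero_of_dvd hdvd),
      Int.emod_eq_of_lt (by omega) hsn]
  omega

theorem Nat.pow_modEq_pow_mod_pow_sub_one {p : ℕ} (hp : 0 < p) (r j : ℕ) :
    p ^ j ≡ p ^ (j % r) [MOD p ^ r - 1] := by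
  have h : p ^ r ≡ 1 [MOD p ^ r - 1] :=
    ((Nat.modEq_iff_dvd' (Nat.one_le_pow _ _ hp)).2 dvd_rfl).symm
  calc p ^ j = p ^ (j % r) * (p ^ r) ^ (j / r) := by
        rw [← pow_mul, ← pow_add, Nat.mod_add_div]
    _ ≡ p ^ (j % r) * 1 ^ (j / r) [MOD p ^ r - 1] := (h.pow _).mul_left _
    _ = p ^ (j % r) := by simp

/-- For `m > 0`, the number `p ^ m - 1` is minimal in its cyclotomic coset modulo
`p ^ (2 * m) - 1`, because it divides every element of the coset and none of them is zero. -/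
theorem pow_sub_one_le_pow_mul_mod {p m : ℕ} (hp : 2 ≤ p) (hm : 0 < m) (j : ℕ) :
    p ^ m - 1 ≤ (p ^ j * (p ^ m - 1)) % (p ^ (2 * m) - 1) := by
  have hpm : p ≤ p ^ m := Nat.le_self_pow hm.ne' p
  have hlt : p ^ m < p ^ (2 * m) := Nat.pow_lt_pow_right hp (by omega)
  have hdvd : p ^ m - 1 ∣ p ^ (2 * m) - 1 := Nat.pow_sub_one_dvd_pow_sub_one p ⟨2, by ring⟩
  refine Nat.le_of_dvd (Nat.pos_of_ne_zero fun h => ?_)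
    ((Nat.dvd_mod_iff hdvd).2 (Dvd.intro_left _ rfl))
  have hcop : Nat.Coprime (p ^ (2 * m) - 1) (p ^ j) := by
    have h1 : Nat.Coprime (p ^ (2 * m) - 1) (p ^ (2 * m)) := by
      rw [Nat.coprime_self_sub_left (by omega)]
      exact Nat.coprime_one_left _
    exact (Nat.Coprime.coprime_dvd_right (dvd_pow_self p (by omega)) h1).pow_right j
  have := Nat.le_of_dvd (by omega) (hcop.dvd_of_dvd_mul_left (Nat.dvd_of_mod_eq_zero h))
  omega

/-- For `m > 0`, the number `p ^ (m + 1) - p - 1` is minimal in its cyclotomic coset modulo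
`p ^ (2 * m + 1) - 1`. -/
theorem pow_succ_sub_sub_one_le_pow_mul_mod {p m : ℕ} (hp : 2 ≤ p) (hm : 0 < m) (j : ℕ) :
    p ^ (m + 1) - p - 1 ≤ (p ^ j * (p ^ (m + 1) - p - 1)) % (p ^ (2 * m + 1) - 1) := by
  rw [(Nat.pow_modEq_pow_mod_pow_sub_one (by omega) (2 * m + 1) j).mul_right]
  have hj := Nat.mod_lt j (Nat.succ_pos (2 * m))
  generalize j % (2 * m + 1) = j at hj ⊢
  have hpm : p ≤ p ^ m := Nat.le_self_pow hm.ne' p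
  have hsub : p + 1 ≤ p ^ (m + 1) := by rw [pow_succ]; nlinarith
  have hN : 1 ≤ p ^ (2 * m + 1) := Nat.one_le_pow _ _ (by omega)
  have hcast : ((p ^ (m + 1) - p - 1 : ℕ) : ℤ) = (p : ℤ) ^ (m + 1) - p - 1 := by
    rw [Nat.sub_sub]
    push_cast [hsub]
    ring
  have hpz : (2 : ℤ) ≤ p := by exact_mod_cast hp
  rcases le_or_gt j m with hjm | hjm
  · have hpj : 0 < p ^ j := Nat.pow_pos (by omega)
    rw [Nat.mod_eq_of_lt]
    · exact Nat.le_mul_of_pos_left _ hpj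
    · have hle : p ^ j * p ^ (m + 1) ≤ p ^ (2 * m + 1) := by
        rw [← pow_add]
        exact Nat.pow_le_pow_right (by omega) (by omega)
      rw [Nat.sub_sub, Nat.mul_sub]
      have : 2 ≤ p ^ j * (p + 1) := by nlinarith
      have : p ^ j * (p + 1) ≤ p ^ j * p ^ (m + 1) := Nat.mul_le_mul_left _ hsub
      omega
  obtain ⟨i, rfl⟩ := Nat.exists_eq_add_of_lt hjm
  rcases Nat.lt_or_ge (i + 1) m with him | him
  · obtain ⟨t, rfl⟩ := Nat.exists_eq_add_of_lt him
    obtain ⟨A, hA⟩ : ∃ A : ℤ, A = (p : ℤ) ^ (i + 1) := ⟨_, rfl⟩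
    obtain ⟨B, hB⟩ : ∃ B : ℤ, B = (p : ℤ) ^ (t + 1) := ⟨_, rfl⟩
    have hA2 : 2 ≤ A := hA ▸ hpz.trans (le_self_pow₀ (by omega) (by omega))
    have hB2 : 2 ≤ B := hB ▸ hpz.trans (le_self_pow₀ (by omega) (by omega))
    have hk : (p : ℤ) ^ (i + 1 + t + 1 + 1) = A * B * p := by rw [hA, hB]; ring
    have hr : (p : ℤ) ^ (2 * (i + 1 + t + 1) + 1) = A ^ 2 * B ^ 2 * p := by rw [hA, hB]; ring
    have hpj : (p : ℤ) ^ (i + 1 + t + 1 + i + 1) = A ^ 2 * B := by rw [hA, hB]; ring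
    have hprod : (0 : ℤ) ≤ A * B * ((A - 1) * (p - 1) - 1) :=
      mul_nonneg (by positivity) (by nlinarith)
    refine Nat.le_mod_of_int_dvd_sub
      (s := A ^ 2 * B ^ 2 * p - 1 + A - A ^ 2 * B * p - A ^ 2 * B) ?_ ?_ ⟨A - 1, ?_⟩
    · rw [hcast, hk]
      have : 0 ≤ A ^ 2 * B * p * (B - 2) := mul_nonneg (by positivity) (by omega)
      nlinarith
    · push_cast [hN]
      rw [hr]
      have h1 : 0 < A ^ 2 * B * p := by positivity
      have h2 : A < A ^ 2 * B := by nlinarith [mul_pos (show 0 < A by omega) (show 0 < B by omega)]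
      linarith
    · push_cast [hN, hcast]
      rw [hr, hpj, hk]
      ring
  · obtain rfl : i + 1 = m := by omega
    obtain ⟨C, hC⟩ : ∃ C : ℤ, C = (p : ℤ) ^ (i + 1) := ⟨_, rfl⟩
    have hC2 : 2 ≤ C := hC ▸ hpz.trans (le_self_pow₀ (by omega) (by omega))
    have hk : (p : ℤ) ^ (i + 1 + 1) = C * p := by rw [hC]; ring
    have hr : (p : ℤ) ^ (2 * (i + 1) + 1) = C ^ 2 * p := by rw [hC]; ring
    have hpj : (p : ℤ) ^ (i + 1 + i + 1) = C ^ 2 := by rw [hC]; ring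
    refine Nat.le_mod_of_int_dvd_sub (s := C ^ 2 * p - C ^ 2 + C - 2) ?_ ?_ ⟨C - 2, ?_⟩
    · rw [hcast, hk]
      have : 0 ≤ C * (C - 1) * ((p : ℤ) - 1) :=
        mul_nonneg (mul_nonneg (by omega) (by omega)) (by omega)
      nlinarith
    · push_cast [hN]
      rw [hr]
      nlinarith
    · push_cast [hN, hcast]
      rw [hr, hpj, hk]
      ring

/-- Lemma 1 of the paper. `p^{r/2} - 1` (for `r` even), respectively
`p^{(r+1)/2} - p - 1` (for `r ≥ 3` odd), is the minimum element of its cyclotomic coset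
modulo `p^r - 1` with respect to `p`. -/
theorem min_of_cyclotomic_coset (p r : ℕ) (hp : p.Prime) (hr : 0 < r) :
    (Even r →
      ∀ j : ℕ, p ^ (r / 2) - 1 ≤ (p ^ j * (p ^ (r / 2) - 1)) % (p ^ r - 1)) ∧
    (Odd r → 3 ≤ r →
      ∀ j : ℕ, p ^ ((r + 1) / 2) - p - 1 ≤
        (p ^ j * (p ^ ((r + 1) / 2) - p - 1)) % (p ^ r - 1)) := by
  constructor
  · rintro ⟨m, rfl⟩ j
    rw [← two_mul, Nat.mul_div_cancel_left m two_pos]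
    exact pow_sub_one_le_pow_mul_mod hp.two_le (by omega) j
  · rintro ⟨m, rfl⟩ hr3 j
    rw [show (2 * m + 1 + 1) / 2 = m + 1 by omega]
    exact pow_succ_sub_sub_one_le_pow_mul_mod hp.two_le (by omega) j
end

section
/- Let p be a prime and r a positive integer. (i) If r is even, then for every integer b with 0 ≤ b < p^{r/2} − 1 and every index j with 0 ≤ j < r, the least nonnegative residue of p^j·b modulo p^r − 1 is strictly less than p^r − p^{r/2}. (ii) If r is odd, then for every integer b with 0 ≤ b ≤ p^{(r+1)/2} − p − 1 and every index j with 0 ≤ j < r, the least nonnegative residue of p^j·b modulo p^r − 1 is strictly less than p^r − p^{(r+1)/2} + p. -/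
theorem mul_pow_mod_pred_le {p r j : ℕ} (b : ℕ) (hp : 0 < p) (hj : j ≤ r) :
    (p ^ j * b) % (p ^ r - 1) ≤ p ^ j * (b % p ^ (r - j)) + b / p ^ (r - j) := by
  have hpow : p ^ j * p ^ (r - j) = (p ^ r - 1) + 1 := by
    rw [← pow_add, Nat.add_sub_cancel' hj, Nat.sub_add_cancel (Nat.pow_pos hp)]
  have key : p ^ j * b =
      p ^ j * (b % p ^ (r - j)) + b / p ^ (r - j) + (p ^ r - 1) * (b / p ^ (r - j)) := by
    conv_lhs => rw [← Nat.mod_add_div b (p ^ (r - j)), mul_add, ← mul_assoc, hpow]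
    ring
  rw [key, Nat.add_mul_mod_self_left]
  exact Nat.mod_le _ _

theorem mul_pow_mod_pred_add_pow_le {p r j : ℕ} (b : ℕ) (hp : 0 < p) (hj : j ≤ r) :
    (p ^ j * b) % (p ^ r - 1) + p ^ j ≤ p ^ r + b / p ^ (r - j) := by
  have hmod : b % p ^ (r - j) + 1 ≤ p ^ (r - j) := Nat.mod_lt _ (Nat.pow_pos hp)
  have hmul := Nat.mul_le_mul_left (p ^ j) hmod
  rw [← pow_add, Nat.add_sub_cancel' hj] at hmul
  linarith [mul_pow_mod_pred_le b hp hj]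

/-- Lemma 2 of the paper. Bounds on the least nonnegative residues
`[p^j · b mod (p^r - 1)]`. -/
theorem residues_of_small_multiples_bound (p r : ℕ) (hp : p.Prime) (hr : 0 < r) :
    (Even r →
      ∀ b : ℕ, b < p ^ (r / 2) - 1 → ∀ j : ℕ, j < r →
        (p ^ j * b) % (p ^ r - 1) < p ^ r - p ^ (r / 2)) ∧
    (Odd r →
      ∀ b : ℕ, b ≤ p ^ ((r + 1) / 2) - p - 1 → ∀ j : ℕ, j < r →
        (p ^ j * b) % (p ^ r - 1) < p ^ r - p ^ ((r + 1) / 2) + p) := by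
  have hp2 := hp.two_le
  constructor
  · rintro ⟨m, rfl⟩ b hb j hj
    rw [show (m + m) / 2 = m by omega] at *
    apply Nat.lt_sub_of_add_lt
    rcases le_or_gt j m with hjm | hjm
    · have hle := Nat.mod_le (p ^ j * b) (p ^ (m + m) - 1)
      have hmono := Nat.mul_le_mul_right b (Nat.pow_le_pow_right hp.pos hjm)
      have hmul := Nat.mul_le_mul_left (p ^ m) (show b + 2 ≤ p ^ m by omega)
      have hpos : 0 < p ^ m := Nat.pow_pos hp.pos
      rw [← pow_add] at hmul
      linarith
    · have hle := mul_pow_mod_pred_add_pow_le b hp.pos hj.le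
      have hdiv : b / p ^ (m + m - j) < p ^ (j - m) := by
        apply Nat.div_lt_of_lt_mul
        rw [← pow_add, show m + m - j + (j - m) = m by omega]
        omega
      have hpj : p ^ j = p ^ (j - m) * p ^ m := by
        rw [← pow_add, Nat.sub_add_cancel hjm.le]
      have ha : 2 ≤ p ^ (j - m) := hp2.trans (Nat.le_self_pow (by omega) p)
      have hq : 2 ≤ p ^ m := by omega
      nlinarith
  · rintro ⟨k, rfl⟩ b hb j hj
    rw [show (2 * k + 1 + 1) / 2 = k + 1 by omega] at *
    suffices h : (p ^ j * b) % (p ^ (2 * k + 1) - 1) + p ^ (k + 1) < p ^ (2 * k + 1) + p by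
      omega
    rcases Nat.eq_zero_or_pos k with rfl | hk
    · have hb0 : b = 0 := by simpa using hb
      subst hb0
      simpa using hp.pos
    have hP : 2 ≤ p ^ k := hp2.trans (Nat.le_self_pow hk.ne' p)
    have hq : p ^ (k + 1) = p ^ k * p := pow_succ p k
    have hpq : p < p ^ (k + 1) := by nlinarith
    rcases le_or_gt j k with hjk | hjk
    · have hle := Nat.mod_le (p ^ j * b) (p ^ (2 * k + 1) - 1)
      have hmono := Nat.mul_le_mul_right b (Nat.pow_le_pow_right hp.pos hjk)
      have hmul := Nat.mul_le_mul_left (p ^ k) (show b + p + 1 ≤ p ^ (k + 1) by omega)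
      rw [← pow_add, show k + (k + 1) = 2 * k + 1 by ring] at hmul
      linarith
    · have hle := mul_pow_mod_pred_add_pow_le b hp.pos hj.le
      have hdiv : b / p ^ (2 * k + 1 - j) < p ^ (j - (k + 1)) * p := by
        apply Nat.div_lt_of_lt_mul
        rw [← pow_succ, ← pow_add,
          show 2 * k + 1 - j + (j - (k + 1) + 1) = k + 1 by omega]
        omega
      have hpj : p ^ j = p ^ (j - (k + 1)) * p ^ (k + 1) := by
        rw [← pow_add, Nat.sub_add_cancel hjk]
      have ha : 1 ≤ p ^ (j - (k + 1)) := Nat.pow_pos hp.pos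
      nlinarith
end

section
/- Let p be a prime. (i) If r is a positive even integer and s is a positive divisor of r/2, then for every integer a with 0 < a ≤ p^{r/2} − 1, the cyclotomic coset { [a·p^{si} mod (p^r − 1)] : i ≥ 0 } has exactly r/s elements. (ii) If r ≥ 3 is odd, then for every integer a with 0 < a ≤ p^{(r+1)/2} − p − 1, the cyclotomic coset { [a·p^{i} mod (p^r − 1)] : i ≥ 0 } has exactly r elements. -/
/-- If `0 < a < p ^ (r - r / 2)`, then multiplication by `p ^ m` fixes the residue of `a`
modulo `p ^ r - 1` only when `r ∣ m`. -/
theorem dvd_of_pow_sub_one_dvd_mul {p r a m : ℕ} (hp : 1 < p) (hr : 0 < r) (ha : 0 < a)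
    (h : a < p ^ (r - r / 2)) (hd : p ^ r - 1 ∣ a * (p ^ m - 1)) : r ∣ m := by
  have hg : p ^ r - 1 ∣ a * (p ^ (m.gcd r) - 1) := by
    rw [← Nat.pow_sub_one_gcd_pow_sub_one, ← Nat.gcd_mul_left]
    exact Nat.dvd_gcd hd (Dvd.intro_left a rfl)
  by_contra hrm
  have hk0 : 0 < m.gcd r := Nat.gcd_pos_of_pos_right m hr
  have hk : m.gcd r ≤ r / 2 := by
    obtain ⟨c, hc⟩ := Nat.gcd_dvd_right m r
    have hc2 : 2 ≤ c := by
      rcases c with _ | _ | c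
      · omega
      · exact absurd (Nat.gcd_eq_right_iff_dvd.mp (by omega)) hrm
      · omega
    rw [Nat.le_div_iff_mul_le two_pos]
    nlinarith
  have hpos : 1 < p ^ (m.gcd r) := Nat.one_lt_pow hk0.ne' hp
  have hle := Nat.le_of_dvd (Nat.mul_pos ha (Nat.sub_pos_of_lt hpos)) hg
  have hkB : p ^ (m.gcd r) ≤ p ^ (r / 2) := Nat.pow_le_pow_right hp.le hk
  have hAB : p ^ r = p ^ (r - r / 2) * p ^ (r / 2) := by
    rw [← pow_add]; congr 1; omega
  obtain ⟨x, hx⟩ := Nat.exists_eq_add_of_lt h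
  obtain ⟨y, hy⟩ := Nat.exists_eq_add_of_le (hpos.le.trans hkB)
  have hmul : a * (p ^ (m.gcd r) - 1) ≤ a * y := Nat.mul_le_mul_left a (by omega)
  rw [hAB, hx, hy] at hle
  have hlt : a * y + 1 < (a + x + 1) * (1 + y) := by nlinarith [Nat.zero_le (x * y)]
  omega

/-- The cyclotomic coset of `a` modulo `p ^ r - 1` with respect to `p ^ s` is full
if `0 < a < p ^ (r - r / 2)` and `s ∣ r`. -/
theorem card_cyclotomic_coset_of_lt {p r s a : ℕ} (hp : 1 < p) (hr : 0 < r) (hs : s ∣ r)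
    (ha : 0 < a) (h : a < p ^ (r - r / 2)) :
    Nat.card { x : ℕ | ∃ i : ℕ, x = (a * p ^ (s * i)) % (p ^ r - 1) } = r / s := by
  obtain ⟨t, rfl⟩ := hs
  have hs0 : 0 < s := Nat.pos_of_mul_pos_right hr
  have ht0 : 0 < t := Nat.pos_of_mul_pos_left hr
  rw [Nat.mul_div_cancel_left t hs0]
  have hone : 1 ≤ p ^ (s * t) := Nat.one_le_pow _ _ (by omega)
  have hper : p ^ (s * t) ≡ 1 [MOD p ^ (s * t) - 1] :=
    ((Nat.modEq_iff_dvd' hone).mpr dvd_rfl).symm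
  have hcop : (p ^ (s * t) - 1).Coprime p := by
    refine Nat.Coprime.coprime_dvd_right (dvd_pow_self p hr.ne') ?_
    exact (Nat.coprime_self_sub_right hone).mpr (Nat.coprime_one_right _) |>.symm
  have hinj : ∀ i j : ℕ, i ≤ j → j < t →
      a * p ^ (s * i) ≡ a * p ^ (s * j) [MOD p ^ (s * t) - 1] → i = j := by
    intro i j hij hjt he
    obtain ⟨d, rfl⟩ := Nat.exists_eq_add_of_le hij
    rw [show a * p ^ (s * (i + d)) = a * p ^ (s * d) * p ^ (s * i) by ring] at he
    have hc := Nat.ModEq.cancel_right_of_coprime (hcop.pow_right (s * i)) he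
    have hd := (Nat.modEq_iff_dvd' (Nat.le_mul_of_pos_right a (by positivity))).mp hc
    rw [show a * p ^ (s * d) - a = a * (p ^ (s * d) - 1) by rw [Nat.mul_sub, mul_one]] at hd
    have hdvd := Nat.dvd_of_mul_dvd_mul_left hs0 (dvd_of_pow_sub_one_dvd_mul hp hr ha h hd)
    have := Nat.eq_zero_of_dvd_of_lt hdvd (by omega)
    omega
  have himage : { x : ℕ | ∃ i : ℕ, x = (a * p ^ (s * i)) % (p ^ (s * t) - 1) } =
      (fun i => (a * p ^ (s * i)) % (p ^ (s * t) - 1)) '' (Finset.range t : Set ℕ) := by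
    ext x
    simp only [Set.mem_ofPred_eq, Set.mem_image, Finset.coe_range, Set.mem_Iio]
    constructor
    · rintro ⟨i, rfl⟩
      refine ⟨i % t, Nat.mod_lt i ht0, Nat.ModEq.mul_left a ?_⟩
      conv_rhs => rw [← Nat.mod_add_div i t, mul_add, pow_add, ← mul_assoc, pow_mul p (s * t)]
      simpa using ((hper.pow (i / t)).mul_left (p ^ (s * (i % t)))).symm
    · rintro ⟨i, -, rfl⟩
      exact ⟨i, rfl⟩
  rw [himage, Nat.card_image_of_injOn, Nat.card_coe_set_eq, Set.ncard_coe_finset,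
    Finset.card_range]
  intro i hi j hj he
  simp only [Finset.coe_range, Set.mem_Iio] at hi hj
  rcases le_total i j with hij | hij
  · exact hinj i j hij hj he
  · exact (hinj j i hij hi he.symm).symm

/-- Lemma 3 of the paper. Cardinality of the cyclotomic coset
of `a` modulo `p^r - 1` with respect to `p^s` (even case), respectively `p` (odd case). -/
theorem card_of_cyclotomic_coset (p r s a : ℕ) (hp : p.Prime) :
    (Even r → 0 < s → s ∣ r / 2 → 0 < a → a ≤ p ^ (r / 2) - 1 →
      Nat.card { x : ℕ | ∃ i : ℕ, x = (a * p ^ (s * i)) % (p ^ r - 1) } = r / s) ∧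
    (Odd r → 3 ≤ r → 0 < a → a ≤ p ^ ((r + 1) / 2) - p - 1 →
      Nat.card { x : ℕ | ∃ i : ℕ, x = (a * p ^ i) % (p ^ r - 1) } = r) := by
  refine ⟨fun hr _ hs ha h => ?_, fun hr _ ha h => ?_⟩
  · obtain ⟨m, rfl⟩ := hr
    have hm : (m + m) / 2 = m := by omega
    rw [hm] at hs h
    have hm0 : m ≠ 0 := by
      rintro rfl
      simp at h
      omega
    refine card_cyclotomic_coset_of_lt hp.one_lt (by omega) (dvd_add hs hs) ha ?_
    rw [hm, Nat.add_sub_cancel]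
    omega
  · obtain ⟨m, rfl⟩ := hr
    have hlt : a < p ^ (2 * m + 1 - (2 * m + 1) / 2) := by
      rw [show 2 * m + 1 - (2 * m + 1) / 2 = (2 * m + 1 + 1) / 2 by omega]
      omega
    simpa using card_cyclotomic_coset_of_lt hp.one_lt (by omega) (one_dvd _) ha hlt
end

section
/- Let p be a prime, r and s positive integers with either (r even and s dividing r/2) or (r odd and s = 1), and q = p^r. Consider the cyclotomic cosets modulo q − 1 with respect to p^s, with minimal representatives 0 = a_0 < a_1 < ⋯ < a_z. Let t_1 be an index with 1 ≤ t_1 < z such that a_{t_1} < p^{r/2} − 1 if r is even, respectively a_{t_1} < p^{(r+1)/2} − p − 1 if r is odd. Put Δ = I_{a_1} ∪ I_{a_2} ∪ ⋯ ∪ I_{a_{t_1}} (taking N = q, so the evaluation points are all of F_q^*), and let C = E_Δ ∩ F_{p^s}^{q−1} be the subfield-subcode of E_Δ. Then C ⊆ C^⊥ (Euclidean duality), dim_{F_{p^s}} C = (r/s)·t_1, and every nonzero codeword of C^⊥ has Hamming weight at least a_{t_1+1}. -/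
/-- The set `U` of `n`-th roots of unity in `F` (the evaluation points). -/
def rootsSet (F : Type) [Field F] [Fintype F] [DecidableEq F] (n : ℕ) : Finset F :=
  Finset.univ.filter (fun α => α ^ n = 1)

/-- The evaluation code `E_Δ ⊆ F^{n}`: the `F`-span of the vectors `(α^d)_{α ∈ U}`, `d ∈ Δ`. -/
noncomputable def evalCode (F : Type) [Field F] [Fintype F] [DecidableEq F] (n : ℕ)
    (Δ : Set ℕ) : Submodule F (↥(rootsSet F n) → F) :=
  Submodule.span F { v | ∃ d ∈ Δ, v = fun α : ↥(rootsSet F n) => (α : F) ^ d }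

/-- The subfield-subcode `E_Δ ∩ F_{q₀}^n`, where the subfield of `F` with `q₀`
elements is described as the set of `x` with `x ^ q₀ = x`. -/
noncomputable def subfieldSubcode (F : Type) [Field F] [Fintype F] [DecidableEq F]
    (n q₀ : ℕ) (Δ : Set ℕ) : Set (↥(rootsSet F n) → F) :=
  { v | v ∈ evalCode F n Δ ∧ ∀ i, v i ^ q₀ = v i }

/-- `x` is the minimal representative of its cyclotomic coset modulo `n`
with respect to `b`. -/
def IsMinRep (b n x : ℕ) : Prop :=
  x < n ∧ ∀ i : ℕ, x ≤ (x * b ^ i) % n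

/-- The union `Δ = I_{a 1} ∪ ⋯ ∪ I_{a t}` of the cyclotomic cosets (modulo `n`,
with respect to `b`) of `a 1, …, a t`. -/
def unionCosets (b n t : ℕ) (a : ℕ → ℕ) : Set ℕ :=
  { x | ∃ i, 1 ≤ i ∧ i ≤ t ∧ ∃ k : ℕ, x = (a i * b ^ k) % n }

theorem card_rootsSet_sum_pow {F : Type} [Field F] [Fintype F] [DecidableEq F] (k : ℕ) :
    ∑ α : ↥(rootsSet F (Fintype.card F - 1)), (α : F) ^ k =
      if Fintype.card F - 1 ∣ k then -1 else 0 := by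
  rw [← FiniteField.sum_pow_units F k]
  have hn : Fintype.card F - 1 ≠ 0 := by
    have := Fintype.one_lt_card (α := F)
    omega
  symm
  refine Fintype.sum_bijective
    (fun u : Fˣ => (⟨(u : F), by
      simpa [rootsSet] using FiniteField.pow_card_sub_one_eq_one (u : F) u.ne_zero⟩ :
      ↥(rootsSet F (Fintype.card F - 1)))) ⟨?_, ?_⟩ _ _ (fun u => rfl)
  · intro u v h
    exact Units.ext (congrArg Subtype.val h)
  · rintro ⟨x, hx⟩
    have hx0 : x ≠ 0 := by
      rintro rfl
      simp [rootsSet, hn] at hx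
    exact ⟨Units.mk0 x hx0, rfl⟩

theorem rootsSet_pow_mod {F : Type} [Field F] [Fintype F] [DecidableEq F] {n : ℕ}
    (α : ↥(rootsSet F n)) (k : ℕ) : (α : F) ^ (k % n) = (α : F) ^ k := by
  have h : (α : F) ^ n = 1 := by simpa [rootsSet] using α.2
  exact (pow_eq_pow_mod k h).symm

theorem rootsSet_ne_zero {F : Type} [Field F] [Fintype F] [DecidableEq F] {n : ℕ}
    (hn : n ≠ 0) (α : ↥(rootsSet F n)) : (α : F) ≠ 0 := by
  intro h0
  have h : (α : F) ^ n = 1 := by simpa [rootsSet] using α.2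
  simp [h0, hn] at h

/-- The trace polynomial `∑_{k < m} X ^ (b ^ k)` evaluated at `x`. -/
def powTrace {F : Type} [Field F] (b m : ℕ) (x : F) : F :=
  ∑ k ∈ Finset.range m, x ^ b ^ k

theorem exists_powTrace_ne_zero {F : Type} [Field F] [Fintype F] {b m : ℕ} (hb : 1 < b)
    (hm : 0 < m) (hF : Fintype.card F = b ^ m) : ∃ x : F, powTrace b m x ≠ 0 := by
  by_contra! h
  have h0 : (∑ k ∈ Finset.range m, (Polynomial.X : Polynomial F) ^ b ^ k) = 0 := by
    refine Polynomial.eq_zero_of_natDegree_lt_card_of_eval_eq_zero _ Function.injective_id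
      (fun x => ?_) ?_
    · simpa [powTrace, Polynomial.eval_finsetSum] using h x
    · rw [hF]
      refine (Polynomial.natDegree_sum_le_of_forall_le (n := b ^ (m - 1)) _ _ ?_).trans_lt
        (Nat.pow_lt_pow_right hb (by omega))
      intro k hk
      rw [Polynomial.natDegree_X_pow]
      exact Nat.pow_le_pow_right (by omega) (by have := Finset.mem_range.1 hk; omega)
  have h1 := congrArg (fun P => Polynomial.coeff P 1) h0
  simp only [Polynomial.finsetSum_coeff, Polynomial.coeff_X_pow, Polynomial.coeff_zero] at h1
  rw [Finset.sum_eq_single_of_mem 0 (Finset.mem_range.2 hm)] at h1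
  · simp at h1
  · intro k _ hk
    rw [if_neg]
    exact (Nat.one_lt_pow hk hb).ne

theorem sum_pow_pow {F ι : Type} [Field F] {p : ℕ} [Fact p.Prime] [CharP F p] (s k : ℕ)
    (t : Finset ι) (f : ι → F) :
    (∑ i ∈ t, f i) ^ (p ^ s) ^ k = ∑ i ∈ t, f i ^ (p ^ s) ^ k := by
  rw [← pow_mul, sum_pow_char_pow]

theorem neg_pow_pow {F : Type} [Field F] {p : ℕ} [Fact p.Prime] [CharP F p] (s k : ℕ) (x : F) :
    (-x) ^ (p ^ s) ^ k = -x ^ (p ^ s) ^ k := by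
  rw [← pow_mul, ← iterateFrobenius_def, map_neg, iterateFrobenius_def]

theorem powTrace_sum {F ι : Type} [Field F] {p : ℕ} [Fact p.Prime] [CharP F p] (s m : ℕ)
    (t : Finset ι) (f : ι → F) :
    powTrace (p ^ s) m (∑ i ∈ t, f i) = ∑ i ∈ t, powTrace (p ^ s) m (f i) := by
  simp only [powTrace, sum_pow_pow]
  exact Finset.sum_comm

theorem pow_pow_of_pow_eq {F : Type} [Field F] {b : ℕ} {y : F} (hy : y ^ b = y) (k : ℕ) :
    y ^ b ^ k = y := by
  induction k with
  | zero => simp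
  | succ k ih => rw [pow_succ, pow_mul, ih, hy]

theorem powTrace_mul_of_pow_eq {F : Type} [Field F] {b m : ℕ} {y : F} (hy : y ^ b = y) (x : F) :
    powTrace b m (y * x) = y * powTrace b m x := by
  simp only [powTrace, Finset.mul_sum, mul_pow, pow_pow_of_pow_eq hy]

theorem powTrace_pow {F : Type} [Field F] [Fintype F] {p : ℕ} [Fact p.Prime] [CharP F p]
    {s m : ℕ} (hF : Fintype.card F = (p ^ s) ^ m) (x : F) :
    powTrace (p ^ s) m x ^ p ^ s = powTrace (p ^ s) m x := by
  have h := sum_pow_pow s 1 (Finset.range m) (fun k => x ^ (p ^ s) ^ k)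
  rw [pow_one] at h
  rw [powTrace, h]
  have h1 := Finset.sum_range_succ (fun k => x ^ (p ^ s) ^ k) m
  rw [Finset.sum_range_succ', ← hF, FiniteField.pow_card] at h1
  simp only [pow_zero, pow_one, add_left_inj] at h1
  simpa only [← pow_mul, pow_succ, mul_assoc, Nat.mul_add, mul_one, pow_add] using h1

theorem powTrace_mem_evalCode {F : Type} [Field F] [Fintype F] [DecidableEq F] {n b m : ℕ}
    {Δ : Set ℕ} {d : ℕ} (hd : ∀ k, (d * b ^ k) % n ∈ Δ) (c : F) :
    (fun α : ↥(rootsSet F n) => powTrace b m (c * (α : F) ^ d)) ∈ evalCode F n Δ := by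
  have : (fun α : ↥(rootsSet F n) => powTrace b m (c * (α : F) ^ d)) =
      ∑ k ∈ Finset.range m,
        c ^ b ^ k • (fun α : ↥(rootsSet F n) => (α : F) ^ ((d * b ^ k) % n)) := by
    ext α
    simp [powTrace, mul_pow, rootsSet_pow_mod, pow_mul]
  rw [this]
  exact Submodule.sum_mem _ fun k _ =>
    Submodule.smul_mem _ _ (Submodule.subset_span ⟨_, hd k, rfl⟩)

theorem evalCode_orthogonal {F : Type} [Field F] [Fintype F] [DecidableEq F] {Δ : Set ℕ}
    (hΔ : ∀ d ∈ Δ, ∀ e ∈ Δ, ¬ Fintype.card F - 1 ∣ d + e)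
    {x y : ↥(rootsSet F (Fintype.card F - 1)) → F}
    (hx : x ∈ evalCode F (Fintype.card F - 1) Δ) (hy : y ∈ evalCode F (Fintype.card F - 1) Δ) :
    ∑ i, x i * y i = 0 := by
  induction hx using Submodule.span_induction with
  | zero => simp
  | add u v _ _ hu hv => simp only [Pi.add_apply, add_mul, Finset.sum_add_distrib, hu, hv, add_zero]
  | smul c u _ hu => simp only [Pi.smul_apply, smul_eq_mul, mul_assoc, ← Finset.mul_sum, hu, mul_zero]
  | mem x hx =>
    obtain ⟨d, hd, rfl⟩ := hx
    induction hy using Submodule.span_induction with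
    | zero => simp
    | add u v _ _ hu hv => simp only [Pi.add_apply, mul_add, Finset.sum_add_distrib, hu, hv, add_zero]
    | smul c u _ hu => simp only [Pi.smul_apply, smul_eq_mul, mul_left_comm _ c, ← Finset.mul_sum, hu, mul_zero]
    | mem y hy =>
      obtain ⟨e, he, rfl⟩ := hy
      simp only [← pow_add]
      rw [card_rootsSet_sum_pow, if_neg (hΔ d hd e he)]

/-- Codewords of the dual of a trace-closed subfield-subcode are orthogonal to the
whole evaluation code. -/
theorem sum_mul_pow_eq_zero_of_orthogonal {F : Type} [Field F] [Fintype F] [DecidableEq F]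
    {p : ℕ} [Fact p.Prime] [CharP F p] {n s m : ℕ} (hs : 0 < s) (hm : 0 < m)
    (hF : Fintype.card F = (p ^ s) ^ m) {Δ : Set ℕ} {d : ℕ}
    (hd : ∀ k, (d * (p ^ s) ^ k) % n ∈ Δ) {y : ↥(rootsSet F n) → F}
    (hy : ∀ i, y i ^ (p ^ s) = y i)
    (horth : ∀ x ∈ subfieldSubcode F n (p ^ s) Δ, ∑ i, x i * y i = 0) :
    ∑ α : ↥(rootsSet F n), y α * (α : F) ^ d = 0 := by
  by_contra hw
  obtain ⟨x, hx⟩ := exists_powTrace_ne_zero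
    (Nat.one_lt_pow hs.ne' (Fact.out (p := p.Prime)).one_lt) hm hF
  set w := ∑ α : ↥(rootsSet F n), y α * (α : F) ^ d
  refine hx ?_
  have h := horth (fun α => powTrace (p ^ s) m (x / w * (α : F) ^ d))
    ⟨powTrace_mem_evalCode hd _, fun i => powTrace_pow hF _⟩
  have hxw : x = ∑ α, x / w * (y α * (α : F) ^ d) := by
    rw [← Finset.mul_sum, div_mul_cancel₀ x hw]
  rw [← h, hxw, powTrace_sum, ← hxw]
  refine Finset.sum_congr rfl fun α _ => ?_
  rw [mul_left_comm, powTrace_mul_of_pow_eq (hy α), mul_comm]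

/-- The BCH bound. -/
theorem bch_bound {F ι : Type} [Field F] [Fintype ι] [DecidableEq F] (α : ι → F)
    (hα : Function.Injective α) (hα0 : ∀ i, α i ≠ 0) {δ : ℕ} {y : ι → F} (hy : y ≠ 0)
    (h : ∀ d, 1 ≤ d → d < δ → ∑ i, y i * α i ^ d = 0) :
    δ ≤ (Finset.univ.filter (fun i => y i ≠ 0)).card := by
  classical
  by_contra! hlt
  obtain ⟨j, hj⟩ := Function.ne_iff.1 hy
  set S := Finset.univ.filter (fun i => y i ≠ 0)
  have hjS : j ∈ S := by simpa [S] using hj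
  set P : Polynomial F := ∏ i ∈ S.erase j, (Polynomial.X - Polynomial.C (α i))
  have hdeg : P.natDegree + 1 = S.card := by
    rw [Polynomial.natDegree_prod_of_monic _ _ fun i _ => Polynomial.monic_X_sub_C _]
    simp [Finset.card_erase_add_one hjS]
  have hzero : ∑ i, y i * (α i * P.eval (α i)) = 0 := by
    simp only [Polynomial.eval_eq_sum_range, Finset.mul_sum]
    rw [Finset.sum_comm]
    refine Finset.sum_eq_zero fun d hd => ?_
    have := h (d + 1) (by omega) (by have := Finset.mem_range.1 hd; omega)
    calc _ = P.coeff d * ∑ i, y i * α i ^ (d + 1) := by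
          rw [Finset.mul_sum]
          exact Finset.sum_congr rfl fun i _ => by ring
      _ = 0 := by rw [this, mul_zero]
  rw [Finset.sum_eq_single j] at hzero
  · refine mul_ne_zero hj (mul_ne_zero (hα0 j) ?_) hzero
    rw [Polynomial.eval_prod, Finset.prod_ne_zero_iff]
    intro i hi
    simpa [sub_eq_zero] using fun hij => (Finset.ne_of_mem_erase hi) (hα hij).symm
  · intro i _ hij
    by_cases hi : y i = 0
    · simp [hi]
    · have : P.eval (α i) = 0 := by
        rw [Polynomial.eval_prod]
        exact Finset.prod_eq_zero (Finset.mem_erase.2 ⟨hij, by simpa [S] using hi⟩) (by simp)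
      simp [this]
  · simp

/-- The `d`-th Fourier coefficient of a word indexed by the nonzero elements of `F`. -/
def rootsFourierCoeff {F : Type} [Field F] [Fintype F] [DecidableEq F]
    (v : ↥(rootsSet F (Fintype.card F - 1)) → F) (d : ℕ) : F :=
  -∑ α, v α * (α : F) ^ ((Fintype.card F - 2) * d)

theorem rootsFourierCoeff_pow {F : Type} [Field F] [Fintype F] [DecidableEq F] (d e : ℕ) :
    rootsFourierCoeff (fun α : ↥(rootsSet F (Fintype.card F - 1)) => (α : F) ^ d) e =
      if d ≡ e [MOD Fintype.card F - 1] then 1 else 0 := by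
  have hq := Fintype.one_lt_card (α := F)
  have hiff : Fintype.card F - 1 ∣ d + (Fintype.card F - 2) * e ↔
      d ≡ e [MOD Fintype.card F - 1] := by
    obtain ⟨n, hn⟩ : ∃ n, Fintype.card F = n + 2 := ⟨Fintype.card F - 2, by omega⟩
    simp only [hn, Nat.add_sub_cancel, show n + 2 - 1 = n + 1 from rfl]
    rw [← Nat.modEq_zero_iff_dvd]
    have h0 : e + n * e ≡ 0 [MOD n + 1] := (Nat.modEq_zero_iff_dvd.2 ⟨e, by ring⟩)
    constructor
    · intro h
      exact Nat.ModEq.add_right_cancel' (n * e) (h.trans h0.symm)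
    · intro h
      exact (h.add_right _).trans h0
  simp only [rootsFourierCoeff, ← pow_add]
  rw [card_rootsSet_sum_pow]
  by_cases h : d ≡ e [MOD Fintype.card F - 1]
  · rw [if_pos (hiff.2 h), if_pos h, neg_neg]
  · rw [if_neg (fun h' => h (hiff.1 h')), if_neg h, neg_zero]

theorem rootsFourierCoeff_add {F : Type} [Field F] [Fintype F] [DecidableEq F]
    (u v : ↥(rootsSet F (Fintype.card F - 1)) → F) (d : ℕ) :
    rootsFourierCoeff (u + v) d = rootsFourierCoeff u d + rootsFourierCoeff v d := by
  simp [rootsFourierCoeff, add_mul, Finset.sum_add_distrib, add_comm]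

theorem rootsFourierCoeff_smul {F : Type} [Field F] [Fintype F] [DecidableEq F] (c : F)
    (v : ↥(rootsSet F (Fintype.card F - 1)) → F) (d : ℕ) :
    rootsFourierCoeff (c • v) d = c * rootsFourierCoeff v d := by
  simp [rootsFourierCoeff, mul_assoc, Finset.mul_sum]

theorem rootsFourierCoeff_zero {F : Type} [Field F] [Fintype F] [DecidableEq F] (d : ℕ) :
    rootsFourierCoeff (0 : ↥(rootsSet F (Fintype.card F - 1)) → F) d = 0 := by
  simp [rootsFourierCoeff]

theorem rootsFourierCoeff_sum {F ι : Type} [Field F] [Fintype F] [DecidableEq F] (t : Finset ι)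
    (f : ι → ↥(rootsSet F (Fintype.card F - 1)) → F) (d : ℕ) :
    rootsFourierCoeff (∑ i ∈ t, f i) d = ∑ i ∈ t, rootsFourierCoeff (f i) d := by
  classical
  induction t using Finset.induction_on with
  | empty => simp [rootsFourierCoeff_zero]
  | insert i t hi ih => rw [Finset.sum_insert hi, Finset.sum_insert hi, rootsFourierCoeff_add, ih]

theorem rootsFourierCoeff_pow_pow {F : Type} [Field F] [Fintype F] [DecidableEq F] {p : ℕ}
    [Fact p.Prime] [CharP F p] {s : ℕ} {v : ↥(rootsSet F (Fintype.card F - 1)) → F}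
    (hv : ∀ i, v i ^ p ^ s = v i) (d k : ℕ) :
    rootsFourierCoeff v d ^ (p ^ s) ^ k = rootsFourierCoeff v (d * (p ^ s) ^ k) := by
  rw [rootsFourierCoeff, neg_pow_pow, sum_pow_pow]
  simp only [rootsFourierCoeff, mul_pow, pow_pow_of_pow_eq (hv _)]
  simp only [← pow_mul, mul_assoc]

theorem rootsFourierCoeff_mod {F : Type} [Field F] [Fintype F] [DecidableEq F]
    (v : ↥(rootsSet F (Fintype.card F - 1)) → F) (d : ℕ) :
    rootsFourierCoeff v (d % (Fintype.card F - 1)) = rootsFourierCoeff v d := by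
  simp only [rootsFourierCoeff]
  congr 1
  refine Finset.sum_congr rfl fun α _ => ?_
  rw [mul_comm _ (d % _), mul_comm _ d, pow_mul, pow_mul, rootsSet_pow_mod]

/-- Fourier inversion on the evaluation code of an injectively enumerated set of exponents. -/
theorem sum_rootsFourierCoeff_smul {F ι : Type} [Field F] [Fintype F] [DecidableEq F] [Fintype ι]
    {e : ι → ℕ} (he : ∀ i j, e i ≡ e j [MOD Fintype.card F - 1] → i = j)
    {v : ↥(rootsSet F (Fintype.card F - 1)) → F}
    (hv : v ∈ evalCode F (Fintype.card F - 1) (Set.range e)) :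
    ∑ j, rootsFourierCoeff v (e j) • (fun α : ↥(rootsSet F (Fintype.card F - 1)) => (α : F) ^ e j)
      = v := by
  induction hv using Submodule.span_induction with
  | zero => simp [rootsFourierCoeff_zero]
  | add u v _ _ hu hv => simp only [rootsFourierCoeff_add, add_smul, Finset.sum_add_distrib, hu, hv]
  | smul c u _ hu => simp only [rootsFourierCoeff_smul, mul_smul, ← Finset.smul_sum, hu]
  | mem x hx =>
    obtain ⟨_, ⟨i, rfl⟩, rfl⟩ := hx
    rw [Finset.sum_eq_single i]
    · rw [rootsFourierCoeff_pow, if_pos (Nat.ModEq.refl _), one_smul]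
    · intro j _ hj
      rw [rootsFourierCoeff_pow, if_neg (fun h => hj (he _ _ h).symm), zero_smul]
    · simp

/-- If the cosets of `a i` (`i : ι`) are distinct and of full size `m`, the subfield-subcode
of their union has `|F| ^ |ι|` elements. -/
theorem card_subfieldSubcode {F ι : Type} [Field F] [Fintype F] [DecidableEq F] [Fintype ι]
    {p : ℕ} [Fact p.Prime] [CharP F p] {s m : ℕ} (hm : 0 < m)
    (hF : Fintype.card F = (p ^ s) ^ m) (a : ι → ℕ)
    (hinj : ∀ i j, ∀ k < m, ∀ l < m,
      a i * (p ^ s) ^ k ≡ a j * (p ^ s) ^ l [MOD Fintype.card F - 1] → i = j ∧ k = l)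
    {Δ : Set ℕ}
    (hΔ : ∀ i k, (a i * (p ^ s) ^ k) % (Fintype.card F - 1) ∈ Δ)
    (hΔ' : ∀ d ∈ Δ, ∃ i, ∃ k < m, d = (a i * (p ^ s) ^ k) % (Fintype.card F - 1)) :
    Nat.card (subfieldSubcode F (Fintype.card F - 1) (p ^ s) Δ) =
      Fintype.card F ^ Fintype.card ι := by
  classical
  set n := Fintype.card F - 1 with hn
  set e : ι × Fin m → ℕ := fun x => (a x.1 * (p ^ s) ^ (x.2 : ℕ)) % n
  have he : ∀ x y, e x ≡ e y [MOD n] → x = y := by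
    rintro ⟨i, k⟩ ⟨j, l⟩ h
    have h' := hinj i j k k.2 l l.2 (((Nat.mod_modEq _ _).symm.trans h).trans (Nat.mod_modEq _ _))
    exact Prod.ext h'.1 (Fin.ext h'.2)
  have hrange : Set.range e = Δ := by
    ext d
    constructor
    · rintro ⟨x, rfl⟩
      exact hΔ _ _
    · intro hd
      obtain ⟨i, k, hk, rfl⟩ := hΔ' d hd
      exact ⟨(i, ⟨k, hk⟩), rfl⟩
  have hexp : ∀ c : ι → F, (∑ i, fun α : ↥(rootsSet F n) => powTrace (p ^ s) m (c i * (α : F) ^ a i))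
      = ∑ x, c x.1 ^ (p ^ s) ^ (x.2 : ℕ) • fun α : ↥(rootsSet F n) => (α : F) ^ e x := by
    intro c
    ext α
    simp only [Finset.sum_apply, Pi.smul_apply, smul_eq_mul, powTrace, Fintype.sum_prod_type,
      Finset.sum_range, mul_pow, e, rootsSet_pow_mod, pow_mul]
  let f : (ι → F) → subfieldSubcode F n (p ^ s) Δ := fun c =>
    ⟨∑ i, fun α => powTrace (p ^ s) m (c i * (α : F) ^ a i),
      Submodule.sum_mem _ fun i _ => powTrace_mem_evalCode (hΔ i) _, fun α => by
        rw [Finset.sum_apply, ← powTrace_sum, powTrace_pow hF]⟩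
  have hf : Function.Bijective f := by
    constructor
    · intro c c' h
      have key : ∀ (c : ι → F) (i : ι), rootsFourierCoeff (f c).1 (e (i, ⟨0, hm⟩)) = c i := by
        intro c i
        change rootsFourierCoeff (∑ i, fun α : ↥(rootsSet F n) =>
          powTrace (p ^ s) m (c i * (α : F) ^ a i)) _ = _
        rw [hexp, rootsFourierCoeff_sum, Finset.sum_eq_single (i, ⟨0, hm⟩)]
        · rw [rootsFourierCoeff_smul, rootsFourierCoeff_pow, if_pos (Nat.ModEq.refl _)]
          simp
        · intro x _ hx
          rw [rootsFourierCoeff_smul, rootsFourierCoeff_pow, if_neg (fun h => hx (he _ _ h)), mul_zero]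
        · simp
      ext i
      rw [← key c, h, key c']
    · rintro ⟨v, hv, hvb⟩
      refine ⟨fun i => rootsFourierCoeff v (a i), Subtype.ext ?_⟩
      change (∑ i, fun α : ↥(rootsSet F n) =>
          powTrace (p ^ s) m (rootsFourierCoeff v (a i) * (α : F) ^ a i)) = v
      rw [hexp (fun i => rootsFourierCoeff v (a i))]
      rw [← hrange] at hv
      refine Eq.trans (Finset.sum_congr rfl fun x _ => ?_) (sum_rootsFourierCoeff_smul he hv)
      rw [rootsFourierCoeff_pow_pow hvb, rootsFourierCoeff_mod]
  rw [← Nat.card_congr (Equiv.ofBijective f hf), Nat.card_eq_fintype_card, Fintype.card_fun]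

theorem pow_modEq_one_sub_one {q : ℕ} (hq : 0 < q) (k : ℕ) : q ^ k ≡ 1 [MOD q - 1] := by
  have h : q ≡ 1 [MOD q - 1] := ((Nat.modEq_iff_dvd' hq).2 dvd_rfl).symm
  simpa using h.pow k

theorem half_bound {p r B : ℕ} (hp : 1 < p) (hr : 0 < r)
    (h : (Even r → B < p ^ (r / 2) - 1) ∧ (Odd r → B < p ^ ((r + 1) / 2) - p - 1)) :
    B * p ^ (r / 2) + B < p ^ r - 1 := by
  rcases Nat.even_or_odd r with he | ho
  · have hB := h.1 he
    obtain ⟨k, rfl⟩ := he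
    rw [show (k + k) / 2 = k by omega] at *
    rw [pow_add]
    generalize p ^ k = P at *
    obtain ⟨Q, rfl⟩ : ∃ Q, P = B + 2 + Q := ⟨P - (B + 2), by omega⟩
    rw [Nat.lt_sub_iff_add_lt]
    nlinarith
  · have hB := h.2 ho
    obtain ⟨k, rfl⟩ := ho
    rw [show (2 * k + 1 + 1) / 2 = k + 1 by omega] at hB
    rw [show (2 * k + 1) / 2 = k by omega, show 2 * k + 1 = k + (k + 1) by ring, pow_add]
    have hP : 0 < p ^ k := by positivity
    rw [pow_succ] at *
    generalize p ^ k = P at *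
    have hB' : B + p + 2 ≤ P * p := by omega
    rw [Nat.lt_sub_iff_add_lt]
    nlinarith [Nat.mul_le_mul_left P hB']

theorem not_dvd_mul_pow_add {p r B x y : ℕ} (hp : 1 < p) (hr : 0 < r)
    (hB : B * p ^ (r / 2) + B < p ^ r - 1) (hx0 : 0 < x) (hx : x ≤ B) (hy0 : 0 < y)
    (hy : y ≤ B) (e : ℕ) : ¬ p ^ r - 1 ∣ x * p ^ e + y := by
  have small : ∀ x y e, x ≤ B → 0 < y → y ≤ B → e ≤ r / 2 → ¬ p ^ r - 1 ∣ x * p ^ e + y := by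
    intro x y e hx hy0 hy he hdvd
    have h1 := Nat.le_of_dvd (by omega) hdvd
    have h2 : x * p ^ e ≤ B * p ^ (r / 2) :=
      Nat.mul_le_mul hx (Nat.pow_le_pow_right (by omega) he)
    omega
  intro hdvd
  have hmod : p ^ e ≡ p ^ (e % r) [MOD p ^ r - 1] := by
    conv_lhs => rw [← Nat.div_add_mod e r, pow_add, pow_mul]
    simpa using (pow_modEq_one_sub_one (q := p ^ r) (by positivity) (e / r)).mul_right (p ^ (e % r))
  have hlt := Nat.mod_lt e hr
  generalize e % r = f at hmod hlt
  have hdvd' : p ^ r - 1 ∣ x * p ^ f + y := by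
    rw [← Nat.modEq_zero_iff_dvd] at hdvd ⊢
    exact (((hmod.mul_left x).add_right y).symm).trans hdvd
  rcases le_or_gt f (r / 2) with hf | hf
  · exact small x y f hx hy0 hy hf hdvd'
  · refine small y x (r - f) hy hx0 hx (by omega) ?_
    have h := hdvd'.mul_right (p ^ (r - f))
    rw [add_mul, mul_assoc, ← pow_add, show f + (r - f) = r by omega] at h
    rw [← Nat.modEq_zero_iff_dvd] at h ⊢
    rw [add_comm]
    have h1 := pow_modEq_one_sub_one (q := p ^ r) (by positivity) 1
    rw [pow_one] at h1
    have h2 := (h1.mul_left x).add_right (y * p ^ (r - f))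
    rw [mul_one] at h2
    exact h2.symm.trans h

theorem not_mul_pow_modEq_self {p r B x e : ℕ} (hp : 1 < p)
    (hB : B * p ^ (r / 2) + B < p ^ r - 1) (hx0 : 0 < x) (hx : x ≤ B) (he0 : 0 < e) (he : e < r) :
    ¬ x * p ^ e ≡ x [MOD p ^ r - 1] := by
  have small : ∀ e, 0 < e → e ≤ r / 2 → ¬ x * p ^ e ≡ x [MOD p ^ r - 1] := by
    intro e he0 he h
    have h2 : x * p ^ e ≤ B * p ^ (r / 2) :=
      Nat.mul_le_mul hx (Nat.pow_le_pow_right (by omega) he)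
    have h3 := Nat.ModEq.eq_of_lt_of_lt h (by omega) (by omega)
    have h4 : 1 < p ^ e := Nat.one_lt_pow (by omega) hp
    nlinarith
  intro h
  rcases le_or_gt e (r / 2) with hf | hf
  · exact small e he0 hf h
  · refine small (r - e) (by omega) (by omega) ?_
    have h1 := h.mul_right (p ^ (r - e))
    rw [mul_assoc, ← pow_add, show e + (r - e) = r by omega] at h1
    have h2 := (pow_modEq_one_sub_one (q := p ^ r) (by positivity) 1).mul_left x
    rw [pow_one, mul_one] at h2
    exact h1.symm.trans h2

/-- Minimal representatives of the same cyclotomic coset coincide. -/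
theorem IsMinRep.eq_of_modEq {b n x y k l m : ℕ} (hb : b ^ m ≡ 1 [MOD n])
    (hx : IsMinRep b n x) (hy : IsMinRep b n y) (hk : k ≤ m) (hl : l ≤ m)
    (h : x * b ^ k ≡ y * b ^ l [MOD n]) : x = y := by
  have le : ∀ x y k l, IsMinRep b n x → IsMinRep b n y → k ≤ m →
      x * b ^ k ≡ y * b ^ l [MOD n] → y ≤ x := by
    intro x y k l hx hy hk h
    have h1 := h.mul_right (b ^ (m - k))
    rw [mul_assoc, ← pow_add, show k + (m - k) = m by omega, mul_assoc, ← pow_add] at h1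
    have h2 := hb.mul_left x
    rw [mul_one] at h2
    calc y ≤ (y * b ^ (l + (m - k))) % n := hy.2 _
      _ = x % n := h1.symm.trans h2
      _ = x := Nat.mod_eq_of_lt hx.1
  exact le_antisymm (le y x l k hy hx hl h.symm) (le x y k l hx hy hk h)

/-- Every residue lies in the cyclotomic coset of a minimal representative. -/
theorem exists_isMinRep {b n m d : ℕ} (hm : 0 < m) (hb : b ^ m ≡ 1 [MOD n]) (hd : d < n) :
    ∃ x, IsMinRep b n x ∧ x ≤ d ∧ ∃ k, d = (x * b ^ k) % n := by
  obtain ⟨j, hj⟩ : ∃ j, ∀ i, (d * b ^ j) % n ≤ (d * b ^ i) % n := by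
    let f : ℕ → ℕ := fun j => (d * b ^ j) % n
    exact ⟨Function.argmin f, fun i => Function.argmin_le f i⟩
  refine ⟨(d * b ^ j) % n, ⟨Nat.mod_lt _ (by omega), fun i => ?_⟩, ?_, m * j - j, ?_⟩
  · rw [Nat.mod_mul_mod, mul_assoc, ← pow_add]
    exact hj _
  · simpa [Nat.mod_eq_of_lt hd] using hj 0
  · rw [Nat.mod_mul_mod, mul_assoc, ← pow_add,
      Nat.add_sub_cancel' (Nat.le_mul_of_pos_left j hm), pow_mul]
    have h := (hb.pow j).mul_left d
    rw [one_pow, mul_one] at h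
    exact ((Nat.mod_eq_of_lt hd).symm.trans h.symm)

/-- Proposition 4 of the paper: self-orthogonality, dimension and
designed distance of the subfield-subcode over `F_{p^s}` of the univariate code of
length `p^r - 1` given by the union of the first `t₁` nonzero cyclotomic cosets. -/
theorem univariate_subfield_subcode_euclidean_full_length
    (p r s z t₁ : ℕ) (hp : p.Prime) (hr : 0 < r) (hs : 0 < s)
    (hrs : (Even r ∧ s ∣ r / 2) ∨ (Odd r ∧ s = 1))
    (F : Type) [Field F] [Fintype F] [DecidableEq F]
    (hF : Fintype.card F = p ^ r)
    (a : ℕ → ℕ)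
    (hmono : StrictMonoOn a (Set.Iic z))
    (hreps : ∀ x : ℕ, (∃ i ≤ z, a i = x) ↔ IsMinRep (p ^ s) (p ^ r - 1) x)
    (ht₁ : 1 ≤ t₁) (ht₁z : t₁ < z)
    (hbound : (Even r → a t₁ < p ^ (r / 2) - 1) ∧
              (Odd r → a t₁ < p ^ ((r + 1) / 2) - p - 1)) :
    (∀ x ∈ subfieldSubcode F (p ^ r - 1) (p ^ s)
        (unionCosets (p ^ s) (p ^ r - 1) t₁ a),
     ∀ y ∈ subfieldSubcode F (p ^ r - 1) (p ^ s)
        (unionCosets (p ^ s) (p ^ r - 1) t₁ a),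
      ∑ i, x i * y i = 0) ∧
    Nat.card (subfieldSubcode F (p ^ r - 1) (p ^ s)
        (unionCosets (p ^ s) (p ^ r - 1) t₁ a)) = (p ^ s) ^ ((r / s) * t₁) ∧
    (∀ y : ↥(rootsSet F (p ^ r - 1)) → F,
      (∀ i, y i ^ (p ^ s) = y i) →
      (∀ x ∈ subfieldSubcode F (p ^ r - 1) (p ^ s)
          (unionCosets (p ^ s) (p ^ r - 1) t₁ a),
        ∑ i, x i * y i = 0) →
      y ≠ 0 →
      a (t₁ + 1) ≤ (Finset.univ.filter (fun i => y i ≠ 0)).card) := by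
  have : Fact p.Prime := ⟨hp⟩
  have hp1 := hp.one_lt
  have : CharP F p := by
    obtain ⟨c, hc⟩ := CharP.exists F
    have := hc
    obtain ⟨k, hcp, hk⟩ := FiniteField.card F c
    have : c = p := by
      rw [hF] at hk
      exact ((Nat.prime_dvd_prime_iff_eq hcp hp).1
        (hcp.dvd_of_dvd_pow (hk ▸ dvd_pow_self c k.ne_zero)))
    exact this ▸ hc
  have hsr : s ∣ r := by
    rcases hrs with ⟨he, h⟩ | ⟨-, rfl⟩
    · exact h.trans (Nat.div_dvd_of_dvd he.two_dvd)
    · exact one_dvd r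
  obtain ⟨m, rfl⟩ := hsr
  have hm : 0 < m := Nat.pos_of_mul_pos_left hr
  have hFm : Fintype.card F = (p ^ s) ^ m := by rw [hF, pow_mul]
  have hB := half_bound hp1 hr hbound
  have hone : (p ^ s) ^ m ≡ 1 [MOD p ^ (s * m) - 1] := by
    rw [← pow_mul]
    simpa using pow_modEq_one_sub_one (q := p ^ (s * m)) (by positivity) 1
  have hpos : ∀ i, 1 ≤ i → i ≤ t₁ → 0 < a i := fun i h1 h2 =>
    (Nat.zero_le _).trans_lt (hmono (Set.mem_Iic.2 (Nat.zero_le z))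
      (Set.mem_Iic.2 (by omega)) (by omega : 0 < i))
  have hle : ∀ i, i ≤ t₁ → a i ≤ a t₁ := fun i hi =>
    hmono.monotoneOn (Set.mem_Iic.2 (by omega)) (Set.mem_Iic.2 (by omega)) hi
  have hmin : ∀ i, i ≤ z → IsMinRep (p ^ s) (p ^ (s * m) - 1) (a i) := fun i hi =>
    (hreps _).1 ⟨i, hi, rfl⟩
  refine ⟨fun x hx y hy => ?_, ?_, fun y hy horth hy0 => ?_⟩
  · have h := @evalCode_orthogonal F _ _ _ (unionCosets (p ^ s) (p ^ (s * m) - 1) t₁ a)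
    rw [hF] at h
    refine h ?_ hx.1 hy.1
    rintro _ ⟨i, hi1, hi, k, rfl⟩ _ ⟨j, hj1, hj, l, rfl⟩ hdvd
    refine not_dvd_mul_pow_add hp1 hr hB (hpos i hi1 hi) (hle i hi) (hpos j hj1 hj) (hle j hj)
      (s * (k + (m * l - l))) ?_
    rw [← Nat.modEq_zero_iff_dvd] at hdvd ⊢
    have h1 := (((Nat.mod_modEq _ _).add (Nat.mod_modEq _ _)).symm.trans hdvd).mul_right
      ((p ^ s) ^ (m * l - l))
    rw [add_mul, mul_assoc, mul_assoc, ← pow_add, ← pow_add,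
      Nat.add_sub_cancel' (Nat.le_mul_of_pos_left l hm), pow_mul _ m, zero_mul] at h1
    have h2 := ((hone.pow l).mul_left (a j)).add_left
      (a i * (p ^ s) ^ (k + (m * l - l)))
    rw [one_pow, mul_one] at h2
    rw [pow_mul p s (k + (m * l - l))]
    exact h2.symm.trans h1
  · have h := card_subfieldSubcode (F := F) hm hFm (fun i : Fin t₁ => a (i + 1))
      (Δ := unionCosets (p ^ s) (p ^ (s * m) - 1) t₁ a)
    rw [hF] at h
    rw [h, Fintype.card_fin, Nat.mul_div_cancel_left m hs, ← pow_mul, ← pow_mul, mul_assoc]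
    · intro i j k hk l hl hmod
      have hij := (hmin _ (by omega)).eq_of_modEq hone (hmin _ (by omega)) hk.le hl.le hmod
      have hij' := hmono.injOn (Set.mem_Iic.2 (by omega)) (Set.mem_Iic.2 (by omega)) hij
      obtain rfl : i = j := Fin.ext (by omega)
      refine ⟨rfl, ?_⟩
      have key : ∀ k l, k < l → l < m →
          ¬ a (i + 1) * (p ^ s) ^ k ≡ a (i + 1) * (p ^ s) ^ l [MOD p ^ (s * m) - 1] := by
        intro k l hkl hl hmod
        refine not_mul_pow_modEq_self (e := s * (l - k)) hp1 hB (hpos (i + 1) (by omega) (by omega))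
          (hle _ (by omega)) (Nat.mul_pos hs (by omega))
          (Nat.mul_lt_mul_of_pos_left (by omega) hs) ?_
        have h1 := hmod.mul_right ((p ^ s) ^ (m - k))
        rw [mul_assoc, mul_assoc, ← pow_add, ← pow_add, show k + (m - k) = m by omega,
          show l + (m - k) = m + (l - k) by omega, pow_add] at h1
        have h2 := hone.mul_left (a (i + 1))
        have h3 := (hone.mul_right ((p ^ s) ^ (l - k))).mul_left (a (i + 1))
        rw [mul_one] at h2
        rw [one_mul] at h3
        rw [pow_mul p s (l - k)]
        exact (h2.symm.trans (h1.trans h3)).symm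
      rcases lt_trichotomy k l with hkl | hkl | hkl
      · exact (key k l hkl hl hmod).elim
      · exact hkl
      · exact (key l k hkl hk hmod.symm).elim
    · exact fun i k => ⟨i + 1, by omega, by omega, k, rfl⟩
    · rintro _ ⟨i, hi1, hi, k, rfl⟩
      refine ⟨⟨i - 1, by omega⟩, k % m, Nat.mod_lt _ hm, ?_⟩
      simp only [show i - 1 + 1 = i by omega]
      have h1 := ((hone.pow (k / m)).mul_right ((p ^ s) ^ (k % m))).mul_left (a i)
      rw [← pow_mul, ← pow_add, Nat.div_add_mod, one_pow, one_mul] at h1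
      exact h1
  · have hn : p ^ (s * m) - 1 ≠ 0 := by omega
    refine bch_bound (fun α : ↥(rootsSet F (p ^ (s * m) - 1)) => (α : F))
      Subtype.val_injective (rootsSet_ne_zero hn) hy0 fun d hd1 hd => ?_
    refine sum_mul_pow_eq_zero_of_orthogonal hs hm hFm (fun k => ?_) hy horth
    obtain ⟨x, hx, hxd, l, hl⟩ := exists_isMinRep hm hone (hd.trans (hmin (t₁ + 1) (by omega)).1)
    obtain ⟨i, hi, rfl⟩ := (hreps x).2 hx
    have hi1 : 1 ≤ i := by
      rcases Nat.eq_zero_or_pos i with rfl | h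
      · have h0 : a 0 = 0 := by
          obtain ⟨j, hj, hj0⟩ := (hreps 0).2 ⟨by omega, fun i => by simp⟩
          have := hmono.monotoneOn (Set.mem_Iic.2 (Nat.zero_le z)) (Set.mem_Iic.2 hj)
            (Nat.zero_le j)
          omega
        simp [h0] at hl
        omega
      · exact h
    have hit : i ≤ t₁ := by
      by_contra! h
      have := hmono.monotoneOn (Set.mem_Iic.2 (by omega : t₁ + 1 ≤ z)) (Set.mem_Iic.2 hi)
        (by omega : t₁ + 1 ≤ i)
      omega
    refine ⟨i, hi1, hit, l + k, ?_⟩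
    rw [hl, Nat.mod_mul_mod, mul_assoc, ← pow_add]
end
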